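/- Assume in addition that γ : W → B is surjective. Then the boundary value problem D_P : dom(D_P) → H is bijective if and only if S(P) : K → range P is bijective. -/

import Mathlib

namespace RelZeta

variable {𝕜 : Type*} [Field 𝕜] {W H B : Type*}
  [AddCommGroup W] [Module 𝕜 W] [AddCommGroup H] [Module 𝕜 H]
  [AddCommGroup B] [Module 𝕜 B]

/-- The Calderon subspace `K = γ(N) = γ(ker D) ⊆ B`. -/
def Calderon (D : W →ₗ[𝕜] H) (γ : W →ₗ[𝕜] B) : Submodule 𝕜 B :=
  (LinearMap.ker D).map γ

/-- The domain `dom(D_P) = {u ∈ W : P(γ u) = 0}` of the boundary value problem. -/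
def bvpDom (γ : W →ₗ[𝕜] B) (P : B →ₗ[𝕜] B) : Submodule 𝕜 W :=
  LinearMap.ker (P.comp γ)

/-- The boundary value problem `D_P : dom(D_P) → H`, the restriction of `D`. -/
def bvp (D : W →ₗ[𝕜] H) (γ : W →ₗ[𝕜] B) (P : B →ₗ[𝕜] B) :
    ↥(bvpDom γ P) →ₗ[𝕜] H :=
  D.comp (bvpDom γ P).subtype

/-- `S(P) : K → range P`, the restriction of `P` to the Calderon subspace. -/
def SP (D : W →ₗ[𝕜] H) (γ : W →ₗ[𝕜] B) (P : B →ₗ[𝕜] B) :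
    ↥(Calderon D γ) →ₗ[𝕜] ↥(LinearMap.range P) :=
  LinearMap.codRestrict (LinearMap.range P) (P.comp (Calderon D γ).subtype)
    (fun c => LinearMap.mem_range_self P _)

theorem bvp_injective_iff (D : W →ₗ[𝕜] H) (γ : W →ₗ[𝕜] B) (P : B →ₗ[𝕜] B)
    (hγinj : Set.InjOn γ (LinearMap.ker D)) :
    Function.Injective (bvp D γ P) ↔ Function.Injective (SP D γ P) := by
  rw [injective_iff_map_eq_zero, injective_iff_map_eq_zero]
  constructor
  · rintro h ⟨_, u, hu, rfl⟩ hP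
    have hu0 : u = 0 := congrArg Subtype.val (h ⟨u, congrArg Subtype.val hP⟩ hu)
    simp [hu0]
  · rintro h ⟨u, hu⟩ hD
    have hγu : γ u = 0 :=
      congrArg Subtype.val (h ⟨γ u, u, hD, rfl⟩ (Subtype.ext hu))
    exact Subtype.ext (hγinj hD (zero_mem (LinearMap.ker D)) (hγu.trans (map_zero γ).symm))

theorem bvp_surjective_iff (D : W →ₗ[𝕜] H) (γ : W →ₗ[𝕜] B) (P : B →ₗ[𝕜] B)
    (hDsurj : Function.Surjective D) (hγsurj : Function.Surjective γ) :
    Function.Surjective (bvp D γ P) ↔ Function.Surjective (SP D γ P) := by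
  constructor
  · rintro h ⟨_, b, rfl⟩
    obtain ⟨w, rfl⟩ := hγsurj b
    obtain ⟨⟨u, hu⟩, hDu⟩ := h (D w)
    have hDu : D u = D w := hDu
    have hu : P (γ u) = 0 := hu
    refine ⟨⟨γ (w - u), w - u, ?_, rfl⟩, Subtype.ext ?_⟩
    · simp [hDu]
    · change P (γ (w - u)) = P (γ w)
      simp [hu]
  · intro h y
    obtain ⟨w, rfl⟩ := hDsurj y
    obtain ⟨⟨_, n, hn, rfl⟩, hPn⟩ := h ⟨P (γ w), γ w, rfl⟩
    have hPn : P (γ n) = P (γ w) := congrArg Subtype.val hPn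
    have hn : D n = 0 := hn
    refine ⟨⟨w - n, ?_⟩, ?_⟩
    · change P (γ (w - n)) = 0
      simp [hPn]
    · change D (w - n) = D w
      simp [hn]

/-- If `γ` is surjective, the boundary value problem `D_P : dom(D_P) → H` is
bijective if and only if `S(P) : K → range P` is bijective. -/
theorem statement10 (D : W →ₗ[𝕜] H) (γ : W →ₗ[𝕜] B) (P : B →ₗ[𝕜] B)
    (hDsurj : Function.Surjective D)
    (hγinj : Set.InjOn γ (LinearMap.ker D))
    (hPidem : P.comp P = P)
    (hγsurj : Function.Surjective γ) :
    Function.Bijective (bvp D γ P) ↔ Function.Bijective (SP D γ P) :=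
  and_congr (bvp_injective_iff D γ P hγinj) (bvp_surjective_iff D γ P hDsurj hγsurj)

end RelZeta
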